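/- Let d ≥ 1, let M be the uncentered maximal operator on ℝ^d associated to balls of the ℓ∞ norm (i.e., cubes with sides parallel to the axes), and let ω be a modulus of continuity. Then ‖M‖_{Op(ω)} = sup_{t > 0} inf_{0 ≤ s ≤ 1} (1/((1+s)^d ω(t))) ∫_{[−s,1]^d} ω(t‖x‖_∞) dλ(x), and equivalently ‖M‖_{Op(ω)} = sup_{t > 0} inf_{0 ≤ s ≤ 1} (d/((1+s)^d ω(t))) [ 2^d ∫_0^s u^{d−1} ω(tu) du + ∫_s^1 (u+s)^{d−1} ω(tu) du ]. -/

import Mathlib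

open MeasureTheory Set Filter Topology

/-- The closed ball of the norm-like function `N`, with center `c` and radius `R`. -/
def nball {d : ℕ} (N : (Fin d → ℝ) → ℝ) (c : Fin d → ℝ) (R : ℝ) : Set (Fin d → ℝ) :=
  {y | N (y - c) ≤ R}

/-- The uncentered Hardy–Littlewood maximal function associated to the norm `N`,
with respect to `d`-dimensional Lebesgue measure. -/
noncomputable def maxFn {d : ℕ} (N : (Fin d → ℝ) → ℝ) (f : (Fin d → ℝ) → ℝ)
    (x : Fin d → ℝ) : ℝ :=
  sSup {a : ℝ | ∃ c : Fin d → ℝ, ∃ R : ℝ, 0 < R ∧ x ∈ nball N c R ∧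
    a = ⨍ y in nball N c R, |f y|}

/-- The modulus of continuity of `g`, with distances measured using `N`. -/
noncomputable def modCont {d : ℕ} (N : (Fin d → ℝ) → ℝ) (g : (Fin d → ℝ) → ℝ) (δ : ℝ) : ℝ :=
  sSup {a : ℝ | ∃ x y : Fin d → ℝ, N (x - y) ≤ δ ∧ a = |g x - g y|}

/-- `N` is a norm on `ℝ^d`. -/
structure IsNorm {d : ℕ} (N : (Fin d → ℝ) → ℝ) : Prop where
  eq_zero_iff : ∀ x, N x = 0 ↔ x = 0
  add_le : ∀ x y, N (x + y) ≤ N x + N y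
  smul : ∀ (a : ℝ) (x), N (a • x) = |a| * N x

/-- `ω` is a modulus of continuity: continuous, nondecreasing, subadditive on `[0,∞)`,
vanishing at `0`, nonnegative, and not identically zero. -/
structure IsModulus (ω : ℝ → ℝ) : Prop where
  nonneg : ∀ t, 0 ≤ t → 0 ≤ ω t
  map_zero : ω 0 = 0
  mono : MonotoneOn ω (Ici 0)
  subadd : ∀ a b, 0 ≤ a → 0 ≤ b → ω (a + b) ≤ ω a + ω b
  cont : ContinuousOn ω (Ici 0)
  nontrivial : ∃ t, 0 < t ∧ ω t ≠ 0

/-- The `Lip(ω)` seminorm of `f`: `sup_{t>0} ω(f,t)/ω(t)`. -/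
noncomputable def lipNorm {d : ℕ} (N : (Fin d → ℝ) → ℝ) (ω : ℝ → ℝ)
    (f : (Fin d → ℝ) → ℝ) : ℝ :=
  sSup {a : ℝ | ∃ t : ℝ, 0 < t ∧ a = modCont N f t / ω t}

/-- The operator norm of the uncentered maximal operator on `Lip(ω)`. -/
noncomputable def opNorm (d : ℕ) (N : (Fin d → ℝ) → ℝ) (ω : ℝ → ℝ) : ℝ :=
  sSup {a : ℝ | ∃ f : (Fin d → ℝ) → ℝ, lipNorm N ω f = 1 ∧ a = lipNorm N ω (maxFn N f)}

/-- The Hölder `α` seminorm of `f`, distances measured with `N`. -/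
noncomputable def holderNorm {d : ℕ} (N : (Fin d → ℝ) → ℝ) (α : ℝ)
    (f : (Fin d → ℝ) → ℝ) : ℝ :=
  sSup {a : ℝ | ∃ x y : Fin d → ℝ, x ≠ y ∧ a = |f x - f y| / N (x - y) ^ α}

/-- The operator norm of the uncentered maximal operator on the Hölder class `Lip_α`. -/
noncomputable def opNormHolder (d : ℕ) (N : (Fin d → ℝ) → ℝ) (α : ℝ) : ℝ :=
  sSup {a : ℝ | ∃ f : (Fin d → ℝ) → ℝ, holderNorm N α f = 1 ∧
    a = holderNorm N α (maxFn N f)}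


section CubeMeasure

variable {d : ℕ}

lemma setIntegral_closedBall_comp_affine (g : (Fin d → ℝ) → ℝ) (c : Fin d → ℝ) {R : ℝ}
    (hR : 0 < R) :
    ∫ w in Metric.closedBall (0 : Fin d → ℝ) 1, g (c + R • w) =
      (R ^ d)⁻¹ * ∫ y in Metric.closedBall c R, g y := by
  rw [Measure.setIntegral_comp_smul volume (fun y => g (c + y)) _ hR.ne',
    smul_closedBall R 0 zero_le_one]
  have h := (measurePreserving_add_left (volume : Measure (Fin d → ℝ)) c).setIntegral_preimage_emb
    (measurableEmbedding_addLeft c) g (Metric.closedBall c R)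
  rw [← h]
  have hpre : (fun x => c + x) ⁻¹' Metric.closedBall c R = Metric.closedBall 0 R := by
    ext x; simp [dist_eq_norm]
  rw [hpre]
  simp [abs_of_pos hR]

lemma volume_real_closedBall_pi (c : Fin d → ℝ) {R : ℝ} (hR : 0 ≤ R) :
    volume.real (Metric.closedBall c R) = (2 * R) ^ d := by
  rw [Measure.real, Real.volume_pi_closedBall _ hR, ENNReal.toReal_ofReal (by positivity)]
  simp

/-- Averages over cubes are averages over the unit cube. -/
lemma average_closedBall_eq (g : (Fin d → ℝ) → ℝ) (c : Fin d → ℝ) {R : ℝ} (hR : 0 < R) :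
    ⨍ y in Metric.closedBall c R, g y =
      ⨍ w in Metric.closedBall (0 : Fin d → ℝ) 1, g (c + R • w) := by
  rw [setAverage_eq, setAverage_eq, setIntegral_closedBall_comp_affine g c hR,
    volume_real_closedBall_pi c hR.le, volume_real_closedBall_pi 0 zero_le_one, smul_eq_mul,
    smul_eq_mul, ← mul_assoc, mul_one, mul_pow, mul_inv]

lemma closedBall_eq_Icc_pi (hd : 1 ≤ d) (c : Fin d → ℝ) (R : ℝ) :
    Metric.closedBall c R = Icc (fun i => c i - R) (fun i => c i + R) := by
  have : Nonempty (Fin d) := ⟨⟨0, hd⟩⟩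
  rw [closedBall_pi', ← Set.pi_univ_Icc]
  simp only [Real.closedBall_eq_Icc]

lemma Icc_pi_eq_closedBall (hd : 1 ≤ d) (a b : ℝ) :
    Icc (fun _ : Fin d => a) (fun _ => b) =
      Metric.closedBall (fun _ : Fin d => (a + b) / 2) ((b - a) / 2) := by
  rw [closedBall_eq_Icc_pi hd]
  congr 1 <;> ext <;> ring

lemma volume_closedBall_inter_closedBall (hd : 1 ≤ d) (r : ℝ) (c : Fin d → ℝ) (R : ℝ) :
    volume (Metric.closedBall (0 : Fin d → ℝ) r ∩ Metric.closedBall c R) =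
      ∏ i, ENNReal.ofReal (min r (c i + R) - max (-r) (c i - R)) := by
  rw [closedBall_eq_Icc_pi hd, closedBall_eq_Icc_pi hd, Icc_inter_Icc, Real.volume_Icc_pi]
  simp

/-- A function whose upper level sets have smaller measure has smaller integral. -/
lemma integral_le_integral_of_meas_le {X : Type*} [MeasurableSpace X] {μ ν : Measure X}
    [IsFiniteMeasure ν] {f : X → ℝ} (hf : Measurable f) (h0 : ∀ x, 0 ≤ f x)
    {C : ℝ} (hC : ∀ x, f x ≤ C) (h : ∀ r, 0 < r → μ {x | r ≤ f x} ≤ ν {x | r ≤ f x}) :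
    ∫ x, f x ∂μ ≤ ∫ x, f x ∂ν := by
  rw [integral_eq_lintegral_of_nonneg_ae (ae_of_all _ h0) hf.aestronglyMeasurable,
    integral_eq_lintegral_of_nonneg_ae (ae_of_all _ h0) hf.aestronglyMeasurable]
  have hi : Integrable f ν := by
    refine Integrable.of_bound hf.aestronglyMeasurable C (ae_of_all _ fun x => ?_)
    rw [Real.norm_eq_abs, abs_of_nonneg (h0 x)]
    exact hC x
  refine ENNReal.toReal_mono ?_ ?_
  · rw [← lt_top_iff_ne_top]
    exact (hasFiniteIntegral_iff_ofReal (ae_of_all _ h0)).1 hi.2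
  · rw [lintegral_eq_lintegral_meas_le μ (ae_of_all _ h0) hf.aemeasurable,
      lintegral_eq_lintegral_meas_le ν (ae_of_all _ h0) hf.aemeasurable]
    exact setLIntegral_mono' measurableSet_Ioi fun r hr => h r hr

lemma integrableOn_closedBall {g : (Fin d → ℝ) → ℝ} (hg : Continuous g) (c : Fin d → ℝ) (R : ℝ) :
    IntegrableOn g (Metric.closedBall c R) :=
  hg.continuousOn.integrableOn_compact (isCompact_closedBall c R)

lemma average_closedBall_mono {g h : (Fin d → ℝ) → ℝ} (hg : Continuous g) (hh : Continuous h)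
    {c : Fin d → ℝ} {R : ℝ} (hgh : ∀ x ∈ Metric.closedBall c R, g x ≤ h x) :
    ⨍ y in Metric.closedBall c R, g y ≤ ⨍ y in Metric.closedBall c R, h y := by
  rw [setAverage_eq, setAverage_eq]
  exact smul_le_smul_of_nonneg_left (setIntegral_mono_on (integrableOn_closedBall hg c R)
    (integrableOn_closedBall hh c R) Metric.isClosed_closedBall.measurableSet hgh)
    (inv_nonneg.2 measureReal_nonneg)

lemma average_closedBall_const (a : ℝ) (c : Fin d → ℝ) {R : ℝ} (hR : 0 < R) :
    ⨍ _y in Metric.closedBall c R, a = a := by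
  rw [setAverage_eq, setIntegral_const, smul_smul, inv_mul_cancel₀, one_smul]
  rw [volume_real_closedBall_pi c hR.le]
  positivity

lemma average_closedBall_add {g h : (Fin d → ℝ) → ℝ} (hg : Continuous g) (hh : Continuous h)
    (c : Fin d → ℝ) (R : ℝ) :
    ⨍ y in Metric.closedBall c R, (g y + h y) =
      (⨍ y in Metric.closedBall c R, g y) + ⨍ y in Metric.closedBall c R, h y := by
  rw [setAverage_eq, setAverage_eq, setAverage_eq, integral_add (integrableOn_closedBall hg c R)
    (integrableOn_closedBall hh c R), smul_add]

/-- Averages over the unit cube are invariant under reflections in the coordinate hyperplanes. -/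
lemma average_unitBall_reflect (g : (Fin d → ℝ) → ℝ) {e : Fin d → ℝ}
    (he : ∀ i, e i = 1 ∨ e i = -1) :
    ⨍ w in Metric.closedBall (0 : Fin d → ℝ) 1, g (fun i => e i * w i) =
      ⨍ w in Metric.closedBall (0 : Fin d → ℝ) 1, g w := by
  have hmp : MeasurePreserving (fun (w : Fin d → ℝ) i => e i * w i) volume volume := by
    refine volume_preserving_pi (f := fun i (x : ℝ) => e i * x) fun i => ?_
    rcases he i with h | h
    · simpa [h, Function.id_def] using MeasurePreserving.id (volume : Measure ℝ)
    · simpa [h] using Measure.measurePreserving_neg (volume : Measure ℝ)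
  have hinv : Function.Involutive (fun (w : Fin d → ℝ) i => e i * w i) := fun w => by
    ext i
    rcases he i with h | h <;> simp [h]
  have hemb : MeasurableEmbedding (fun (w : Fin d → ℝ) i => e i * w i) :=
    (MeasurableEquiv.mk hinv.toPerm hmp.measurable hmp.measurable).measurableEmbedding
  have hpre : (fun (w : Fin d → ℝ) i => e i * w i) ⁻¹' Metric.closedBall 0 1 =
      Metric.closedBall 0 1 := by
    ext w
    simp only [mem_preimage, mem_closedBall_zero_iff, pi_norm_le_iff_of_nonneg zero_le_one]
    refine forall_congr' fun i => ?_
    rcases he i with h | h <;> simp [h]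
  rw [setAverage_eq, setAverage_eq, ← hmp.setIntegral_preimage_emb hemb g, hpre]

end CubeMeasure

section Radial

/-- The distribution of the `ℓ∞` norm on the cube `[-s,1]^d`. -/
lemma map_norm_restrict_Icc (n : ℕ) {s : ℝ} (hs0 : 0 ≤ s) (hs1 : s ≤ 1) :
    Measure.map (fun x : Fin (n + 1) → ℝ => ‖x‖)
      (volume.restrict (Icc (fun _ : Fin (n + 1) => -s) (fun _ => 1))) =
    (volume.restrict (Icc (0 : ℝ) 1)).withDensity (fun u => ENNReal.ofReal
      ((n + 1) * (u + min u s) ^ n * (if u < s then 2 else 1))) := by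
  have : IsFiniteMeasure
      (volume.restrict (Icc (fun _ : Fin (n + 1) => -s) (fun _ => (1 : ℝ)))) :=
    ⟨by simpa using isCompact_Icc.measure_lt_top⟩
  refine Measure.ext_of_Iic _ _ fun a => ?_
  rw [Measure.map_apply continuous_norm.measurable measurableSet_Iic,
    withDensity_apply _ measurableSet_Iic, Measure.restrict_restrict measurableSet_Iic,
    Measure.restrict_apply (continuous_norm.measurable measurableSet_Iic)]
  rcases lt_or_ge a 0 with ha | ha
  · have h1 : (fun x : Fin (n + 1) → ℝ => ‖x‖) ⁻¹' Iic a = ∅ := by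
      ext x
      simp only [mem_preimage, mem_Iic, mem_empty_iff_false, iff_false, not_le]
      exact ha.trans_le (norm_nonneg x)
    have h2 : Iic a ∩ Icc (0 : ℝ) 1 = ∅ := by
      ext x
      simp only [mem_inter_iff, mem_Iic, mem_Icc, mem_empty_iff_false, iff_false]
      rintro ⟨h, h', -⟩
      linarith
    simp [h1, h2]
  have h1 : (fun x : Fin (n + 1) → ℝ => ‖x‖) ⁻¹' Iic a ∩
      Icc (fun _ : Fin (n + 1) => -s) (fun _ => 1) =
      Icc (fun _ : Fin (n + 1) => -min a s) (fun _ => min a 1) := by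
    ext x
    simp only [mem_inter_iff, mem_preimage, mem_Iic, pi_norm_le_iff_of_nonneg ha, mem_Icc,
      Pi.le_def, Real.norm_eq_abs, abs_le, ← forall_and]
    refine forall_congr' fun i => ?_
    rw [le_min_iff, neg_le (a := min a s), le_min_iff, ← neg_le (a := a), ← neg_le (a := s)]
    tauto
  have h2 : Iic a ∩ Icc (0 : ℝ) 1 = Icc 0 (min a 1) := by
    ext x
    simp only [mem_inter_iff, mem_Iic, mem_Icc, le_min_iff]
    tauto
  have hc : 0 ≤ min a 1 := le_min ha zero_le_one
  have hms : min (min a 1) s = min a s := by rw [min_assoc, min_eq_right hs1]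
  have hint : IntervalIntegrable (fun u : ℝ => ((n + 1) * (u + min u s) ^ n *
      (if u < s then 2 else 1) : ℝ)) volume 0 (min a 1) := by
    have hi : IntegrableOn (fun u : ℝ => ((n + 1) * (u + min u s) ^ n : ℝ))
        (uIoc 0 (min a 1)) :=
      intervalIntegrable_iff.1 (Continuous.intervalIntegrable (by fun_prop) _ _)
    refine intervalIntegrable_iff.2 (Integrable.mul_bdd (c := 2) hi ?_ ?_)
    · exact (Measurable.ite measurableSet_Iio measurable_const
        measurable_const).aestronglyMeasurable
    · refine ae_of_all _ fun u => ?_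
      split_ifs <;> norm_num
  have hF := integral_eq_of_hasDerivAt_off_countable
    (fun u : ℝ => (u + min u s) ^ (n + 1))
    (fun u : ℝ => ((n + 1) * (u + min u s) ^ n * (if u < s then 2 else 1) : ℝ))
    (a := 0) (b := min a 1) (s := {s}) (countable_singleton s) (by fun_prop)
    (fun u hu => by
      have hus : u ≠ s := fun h => hu.2 h
      rcases lt_or_gt_of_ne hus with h | h
      · have hd : HasDerivAt (fun u : ℝ => (u + u) ^ (n + 1))
            (((n + 1 : ℕ) : ℝ) * (u + u) ^ n * (1 + 1)) u :=
          ((hasDerivAt_id u).add (hasDerivAt_id u)).pow (n + 1)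
        rw [min_eq_left h.le, if_pos h]
        refine (hd.congr_of_eventuallyEq ?_).congr_deriv (by push_cast; norm_num)
        filter_upwards [Iio_mem_nhds h] with v hv
        rw [min_eq_left (le_of_lt hv)]
      · have hd : HasDerivAt (fun u : ℝ => (u + s) ^ (n + 1))
            (((n + 1 : ℕ) : ℝ) * (u + s) ^ n * 1) u :=
          ((hasDerivAt_id u).add_const s).pow (n + 1)
        rw [min_eq_right h.le, if_neg h.not_gt]
        refine (hd.congr_of_eventuallyEq ?_).congr_deriv (by push_cast; norm_num)
        filter_upwards [Ioi_mem_nhds h] with v hv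
        rw [min_eq_right (le_of_lt hv)])
    hint
  rw [h1, h2, Real.volume_Icc_pi, Finset.prod_const, Finset.card_univ, Fintype.card_fin,
    ← ENNReal.ofReal_pow (by have := le_min ha hs0; linarith), sub_neg_eq_add,
    ← ofReal_integral_eq_lintegral_ofReal]
  · rw [integral_Icc_eq_integral_Ioc, ← intervalIntegral.integral_of_le hc, hF, hms]
    simp [hs0]
  · rwa [← IntegrableOn, integrableOn_Icc_iff_integrableOn_Ioc,
      ← intervalIntegrable_iff_integrableOn_Ioc_of_le hc]
  · filter_upwards [ae_restrict_mem measurableSet_Icc] with u hu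
    have : 0 ≤ u + min u s := add_nonneg hu.1 (le_min hu.1 hs0)
    simp only [Pi.zero_apply]
    split_ifs <;> positivity

/-- Integration of a radial function over `[-s,1]^d` in `ℓ∞` polar coordinates. -/
lemma setIntegral_Icc_radial {d : ℕ} (hd : 1 ≤ d) {s : ℝ} (hs0 : 0 ≤ s) (hs1 : s ≤ 1)
    {φ : ℝ → ℝ} (hφ : ContinuousOn φ (Ici 0)) :
    ∫ x in Icc (fun _ : Fin d => -s) (fun _ : Fin d => 1), φ ‖x‖ =
      (d : ℝ) * (2 ^ d * (∫ u in Icc (0 : ℝ) s, u ^ (d - 1) * φ u) +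
        ∫ u in Icc s (1 : ℝ), (u + s) ^ (d - 1) * φ u) := by
  obtain ⟨n, rfl⟩ : ∃ n, d = n + 1 := ⟨d - 1, by omega⟩
  have hcont : Continuous (fun u => φ |u|) := hφ.comp_continuous continuous_abs fun u => abs_nonneg u
  have hmap := integral_map (μ := volume.restrict
      (Icc (fun _ : Fin (n + 1) => -s) (fun _ : Fin (n + 1) => (1 : ℝ))))
    (φ := fun x : Fin (n + 1) → ℝ => ‖x‖) continuous_norm.measurable.aemeasurable
    (f := fun u => φ |u|) hcont.aestronglyMeasurable
  simp only [abs_norm] at hmap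
  have hm : Measurable (fun u : ℝ => ENNReal.ofReal
      ((n + 1) * (u + min u s) ^ n * (if u < s then 2 else 1))) := by
    refine ENNReal.measurable_ofReal.comp (Measurable.mul (by fun_prop) ?_)
    exact Measurable.ite measurableSet_Iio measurable_const measurable_const
  rw [← hmap, map_norm_restrict_Icc n hs0 hs1,
    integral_withDensity_eq_integral_toReal_smul hm (ae_of_all _ fun _ => ENNReal.ofReal_lt_top)]
  have hunion : Icc (0 : ℝ) 1 = Ico 0 s ∪ Icc s 1 := (Ico_union_Icc_eq_Icc hs0 hs1).symm
  have hdisj : Disjoint (Ico 0 s) (Icc s 1) := by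
    rw [Set.disjoint_left]
    rintro x hx hx'
    exact absurd hx.2 hx'.1.not_gt
  have e1 : EqOn (fun u => (ENNReal.ofReal
      ((n + 1) * (u + min u s) ^ n * (if u < s then 2 else 1))).toReal • φ |u|)
      (fun u => ((n + 1 : ℕ) * 2 ^ (n + 1)) * (u ^ n * φ |u|)) (Ico 0 s) := fun u hu => by
    have := hu.1
    simp only [min_eq_left hu.2.le, if_pos hu.2, smul_eq_mul]
    rw [ENNReal.toReal_ofReal (by positivity)]
    push_cast
    rw [← two_mul, mul_pow]
    ring
  have e2 : EqOn (fun u => (ENNReal.ofReal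
      ((n + 1) * (u + min u s) ^ n * (if u < s then 2 else 1))).toReal • φ |u|)
      (fun u => ((n + 1 : ℕ) : ℝ) * ((u + s) ^ n * φ |u|)) (Icc s 1) := fun u hu => by
    have := hs0.trans hu.1
    simp only [min_eq_right hu.1, if_neg hu.1.not_gt, smul_eq_mul]
    rw [ENNReal.toReal_ofReal (by positivity)]
    push_cast
    ring
  have i1 : IntegrableOn (fun u => ((n + 1 : ℕ) * 2 ^ (n + 1) : ℝ) * (u ^ n * φ |u|)) (Ico 0 s) :=
    (continuous_const.mul ((continuous_pow n).mul hcont)).integrableOn_Icc.mono_set Ico_subset_Icc_self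
  have i2 : IntegrableOn (fun u => ((n + 1 : ℕ) : ℝ) * ((u + s) ^ n * φ |u|)) (Icc s 1) :=
    (continuous_const.mul (((continuous_add_const s).pow n).mul hcont)).integrableOn_Icc
  rw [hunion, setIntegral_union hdisj measurableSet_Icc
    (i1.congr_fun e1.symm measurableSet_Ico) (i2.congr_fun e2.symm measurableSet_Icc),
    setIntegral_congr_fun measurableSet_Ico e1, setIntegral_congr_fun measurableSet_Icc e2,
    integral_const_mul, integral_const_mul, ← integral_Icc_eq_integral_Ico,
    Nat.add_sub_cancel]
  have f1 : ∫ u in Icc 0 s, u ^ n * φ |u| = ∫ u in Icc 0 s, u ^ n * φ u :=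
    setIntegral_congr_fun measurableSet_Icc fun u hu => by simp only [abs_of_nonneg hu.1]
  have f2 : ∫ u in Icc s 1, (u + s) ^ n * φ |u| = ∫ u in Icc s 1, (u + s) ^ n * φ u :=
    setIntegral_congr_fun measurableSet_Icc fun u hu => by
      simp only [abs_of_nonneg (hs0.trans hu.1)]
  rw [f1, f2]
  ring

end Radial

section Modulus

variable {ω : ℝ → ℝ}

lemma IsModulus.pos (hω : IsModulus ω) {t : ℝ} (ht : 0 < t) : 0 < ω t := by
  refine (hω.nonneg t ht.le).lt_of_ne fun h0 => ?_
  obtain ⟨u, hu, hu0⟩ := hω.nontrivial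
  have key : ∀ n : ℕ, ω (n * t) = 0 := by
    intro n
    induction n with
    | zero => simpa using hω.map_zero
    | succ n ih =>
      have h1 := hω.subadd (n * t) t (by positivity) ht.le
      have h2 := hω.nonneg ((n + 1 : ℕ) * t) (by positivity)
      push_cast at h2 ⊢
      rw [add_mul, one_mul] at h2 ⊢
      linarith
  obtain ⟨n, hn⟩ := exists_nat_gt (u / t)
  have h1 : u ≤ n * t := ((div_lt_iff₀ ht).1 hn).le
  have h2 := hω.mono (mem_Ici.2 hu.le) (mem_Ici.2 (hu.le.trans h1)) h1
  rw [key] at h2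
  exact hu0 (le_antisymm h2 (hω.nonneg u hu.le))

lemma IsModulus.abs_sub_le (hω : IsModulus ω) {a b : ℝ} (ha : 0 ≤ a) (hb : 0 ≤ b) :
    |ω a - ω b| ≤ ω |a - b| := by
  wlog h : b ≤ a generalizing a b
  · rw [abs_sub_comm, abs_sub_comm a]
    exact this hb ha (le_of_not_ge h)
  have h1 := hω.subadd b (a - b) hb (sub_nonneg.2 h)
  rw [add_sub_cancel] at h1
  rw [abs_of_nonneg (sub_nonneg.2 (hω.mono hb ha h)), abs_of_nonneg (sub_nonneg.2 h)]
  linarith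

lemma IsModulus.continuous_comp (hω : IsModulus ω) {X : Type*} [TopologicalSpace X] {g : X → ℝ}
    (hg : Continuous g) (h0 : ∀ x, 0 ≤ g x) : Continuous fun x => ω (g x) :=
  hω.cont.comp_continuous hg h0

lemma IsModulus.tendsto_zero (hω : IsModulus ω) : Tendsto ω (𝓝[>] 0) (𝓝 0) := by
  have h := hω.cont 0 self_mem_Ici
  rw [ContinuousWithinAt, hω.map_zero] at h
  exact h.mono_left (nhdsWithin_mono _ Ioi_subset_Ici_self)

lemma IsModulus.continuous_of_le (hω : IsModulus ω) {d : ℕ} {f : (Fin d → ℝ) → ℝ}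
    (hf : ∀ x y, |f x - f y| ≤ ω ‖x - y‖) : Continuous f := by
  rw [continuous_iff_continuousAt]
  intro x
  rw [ContinuousAt, tendsto_iff_dist_tendsto_zero]
  have hc : Continuous fun y => ω ‖y - x‖ :=
    hω.continuous_comp (by fun_prop) fun _ => norm_nonneg _
  have h0 : Tendsto (fun y => ω ‖y - x‖) (𝓝 x) (𝓝 0) := by
    have := hc.tendsto x
    rwa [sub_self, norm_zero, hω.map_zero] at this
  exact squeeze_zero (fun _ => dist_nonneg) (fun y => hf y x) h0

end Modulus

section Seminorm

variable {d : ℕ} {ω : ℝ → ℝ}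

lemma nball_norm_eq (c : Fin d → ℝ) (R : ℝ) :
    nball (fun x => ‖x‖) c R = Metric.closedBall c R := by
  ext y
  simp [nball, dist_eq_norm]

/-- If the oscillation of `f` is bounded at one scale then it is bounded at every scale. -/
lemma bddAbove_oscillation {f : (Fin d → ℝ) → ℝ} {t : ℝ} (ht : 0 < t)
    (h : BddAbove {a : ℝ | ∃ x y : Fin d → ℝ, ‖x - y‖ ≤ t ∧ a = |f x - f y|}) (u : ℝ) :
    BddAbove {a : ℝ | ∃ x y : Fin d → ℝ, ‖x - y‖ ≤ u ∧ a = |f x - f y|} := by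
  have key : ∀ n : ℕ,
      BddAbove {a : ℝ | ∃ x y : Fin d → ℝ, ‖x - y‖ ≤ 2 ^ n * t ∧ a = |f x - f y|} := by
    intro n
    induction n with
    | zero => simpa using h
    | succ n ih =>
      obtain ⟨C, hC⟩ := ih
      refine ⟨C + C, ?_⟩
      rintro _ ⟨x, y, hxy, rfl⟩
      have hm : ‖(2⁻¹ : ℝ) • (x - y)‖ ≤ 2 ^ n * t := by
        rw [norm_smul]
        norm_num
        rw [pow_succ] at hxy
        linarith
      have h1 := hC ⟨x, (2⁻¹ : ℝ) • (x + y), by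
        convert hm using 2; module, rfl⟩
      have h2 := hC ⟨(2⁻¹ : ℝ) • (x + y), y, by
        convert hm using 2; module, rfl⟩
      exact (abs_sub_le _ _ _).trans (add_le_add h1 h2)
  obtain ⟨n, hn⟩ := pow_unbounded_of_one_lt (u / t) (one_lt_two : (1 : ℝ) < 2)
  refine (key n).mono ?_
  rintro a ⟨x, y, hxy, rfl⟩
  exact ⟨x, y, hxy.trans ((div_lt_iff₀ ht).1 hn).le, rfl⟩

/-- A function of `Lip(ω)` seminorm one has modulus of continuity at most `ω`. -/
lemma abs_sub_le_of_lipNorm_eq_one (hω : IsModulus ω) {f : (Fin d → ℝ) → ℝ}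
    (hf : lipNorm (fun x => ‖x‖) ω f = 1) (x y : Fin d → ℝ) : |f x - f y| ≤ ω ‖x - y‖ := by
  have hbdd : BddAbove {a : ℝ | ∃ t : ℝ, 0 < t ∧ a = modCont (fun x => ‖x‖) f t / ω t} := by
    by_contra h
    rw [lipNorm, Real.sSup_of_not_bddAbove h] at hf
    exact zero_ne_one hf
  obtain ⟨t, ht, hosc⟩ : ∃ t : ℝ, 0 < t ∧
      BddAbove {a : ℝ | ∃ x y : Fin d → ℝ, ‖x - y‖ ≤ t ∧ a = |f x - f y|} := by
    by_contra! h
    have h0 : {a : ℝ | ∃ t : ℝ, 0 < t ∧ a = modCont (fun x => ‖x‖) f t / ω t} ⊆ {0} := by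
      rintro _ ⟨t, ht, rfl⟩
      rw [modCont, Real.sSup_of_not_bddAbove (h t ht), zero_div]
      rfl
    have : lipNorm (fun x => ‖x‖) ω f ≤ 0 := Real.sSup_nonpos fun a ha => (h0 ha).le
    rw [hf] at this
    linarith
  rcases eq_or_ne x y with rfl | hne
  · simp [hω.map_zero]
  have hpos : 0 < ‖x - y‖ := norm_pos_iff.2 (sub_ne_zero.2 hne)
  have h1 : |f x - f y| ≤ modCont (fun x => ‖x‖) f ‖x - y‖ :=
    le_csSup (bddAbove_oscillation ht hosc _) ⟨x, y, le_rfl, rfl⟩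
  have h2 : modCont (fun x => ‖x‖) f ‖x - y‖ / ω ‖x - y‖ ≤ 1 :=
    hf ▸ le_csSup hbdd ⟨_, hpos, rfl⟩
  rw [div_le_one (hω.pos hpos)] at h2
  exact h1.trans h2

/-- A pointwise bound by `K * ω` bounds every quotient defining the `Lip(ω)` seminorm. -/
lemma modCont_div_le (hω : IsModulus ω) {g : (Fin d → ℝ) → ℝ} {K : ℝ} (hK : 0 ≤ K)
    (hg : ∀ x y, |g x - g y| ≤ K * ω ‖x - y‖) {t : ℝ} (ht : 0 < t) :
    modCont (fun x => ‖x‖) g t / ω t ≤ K := by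
  rw [div_le_iff₀ (hω.pos ht)]
  refine Real.sSup_le ?_ (mul_nonneg hK (hω.nonneg t ht.le))
  rintro _ ⟨x, y, hxy, rfl⟩
  exact (hg x y).trans
    (mul_le_mul_of_nonneg_left (hω.mono (norm_nonneg _) ht.le hxy) hK)

lemma lipNorm_le (hω : IsModulus ω) {g : (Fin d → ℝ) → ℝ} {K : ℝ} (hK : 0 ≤ K)
    (hg : ∀ x y, |g x - g y| ≤ K * ω ‖x - y‖) : lipNorm (fun x => ‖x‖) ω g ≤ K := by
  refine Real.sSup_le ?_ hK
  rintro _ ⟨t, ht, rfl⟩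
  exact modCont_div_le hω hK hg ht

lemma div_le_lipNorm (hω : IsModulus ω) {g : (Fin d → ℝ) → ℝ} {K : ℝ} (hK : 0 ≤ K)
    (hg : ∀ x y, |g x - g y| ≤ K * ω ‖x - y‖) {x y : Fin d → ℝ} (hxy : x ≠ y) :
    |g x - g y| / ω ‖x - y‖ ≤ lipNorm (fun x => ‖x‖) ω g := by
  have hpos : 0 < ‖x - y‖ := norm_pos_iff.2 (sub_ne_zero.2 hxy)
  have hb : BddAbove {a : ℝ | ∃ x' y' : Fin d → ℝ, ‖x' - y'‖ ≤ ‖x - y‖ ∧ a = |g x' - g y'|} := by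
    refine ⟨K * ω ‖x - y‖, ?_⟩
    rintro _ ⟨x', y', h, rfl⟩
    exact (hg x' y').trans
      (mul_le_mul_of_nonneg_left (hω.mono (norm_nonneg _) (norm_nonneg _) h) hK)
  calc |g x - g y| / ω ‖x - y‖ ≤ modCont (fun x => ‖x‖) g ‖x - y‖ / ω ‖x - y‖ :=
        div_le_div_of_nonneg_right (le_csSup hb ⟨x, y, le_rfl, rfl⟩) (hω.pos hpos).le
    _ ≤ lipNorm (fun x => ‖x‖) ω g := by
        refine le_csSup ⟨K, ?_⟩ ⟨_, hpos, rfl⟩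
        rintro _ ⟨t, ht, rfl⟩
        exact modCont_div_le hω hK hg ht

end Seminorm

section CubeAverage

variable {d : ℕ} {ω : ℝ → ℝ}

/-- The average over `[-s,1]^d` as a normalized integral. -/
lemma integral_Icc_div_eq_average (hd : 1 ≤ d) {s : ℝ} (hs : 0 ≤ s) (g : (Fin d → ℝ) → ℝ) :
    (∫ x in Icc (fun _ : Fin d => -s) (fun _ : Fin d => (1 : ℝ)), g x) / (1 + s) ^ d =
      ⨍ x in Metric.closedBall (fun _ : Fin d => (1 - s) / 2) ((1 + s) / 2), g x := by
  rw [Icc_pi_eq_closedBall hd, setAverage_eq, smul_eq_mul, div_eq_inv_mul, sub_neg_eq_add,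
    neg_add_eq_sub, volume_real_closedBall_pi _ (by positivity)]
  congr 3
  ring

/-- Coupling of a cube with a larger cube that reaches a nearby point. -/
lemma average_le_average_add (hω : IsModulus ω) {g : (Fin d → ℝ) → ℝ}
    (hg : ∀ x y, |g x - g y| ≤ ω ‖x - y‖) {c x y : Fin d → ℝ} {R t s : ℝ} (hR : 0 < R)
    (hx : x ∈ Metric.closedBall c R) (ht : 0 < t) (hxy : ‖x - y‖ ≤ t) (hs0 : 0 ≤ s)
    (hs1 : s ≤ 1) :
    ∃ c' : Fin d → ℝ, ∃ R' : ℝ, 0 < R' ∧ y ∈ Metric.closedBall c' R' ∧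
      ⨍ z in Metric.closedBall c R, g z ≤ (⨍ z in Metric.closedBall c' R', g z) +
        ⨍ z in Metric.closedBall (fun _ : Fin d => (1 - s) / 2) ((1 + s) / 2), ω (t * ‖z‖) := by
  set e : Fin d → ℝ := fun i => if c i ≤ y i then 1 else -1 with he
  have he1 : ∀ i, e i = 1 ∨ e i = -1 := fun i => by
    simp only [he]; split_ifs <;> simp
  have hgc := hω.continuous_of_le hg
  have hR' : 0 < R + t * ((1 + s) / 2) := by positivity
  refine ⟨c + (t * ((1 - s) / 2)) • e, R + t * ((1 + s) / 2), hR', ?_, ?_⟩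
  · rw [mem_closedBall_iff_norm, pi_norm_le_iff_of_nonneg hR'.le] at *
    rw [pi_norm_le_iff_of_nonneg hR.le] at hx
    rw [pi_norm_le_iff_of_nonneg ht.le] at hxy
    intro i
    have h1 := abs_le.1 (hx i)
    have h2 := abs_le.1 (hxy i)
    have hts : 0 ≤ t * s := by positivity
    have hts1 : t * s ≤ t := mul_le_of_le_one_right ht.le hs1
    simp only [Pi.sub_apply, Pi.add_apply, Pi.smul_apply, smul_eq_mul] at h1 h2 ⊢
    rw [Real.norm_eq_abs, abs_le]
    simp only [he]
    split_ifs with h <;> constructor <;> nlinarith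
  · rw [average_closedBall_eq g c hR, average_closedBall_eq g _ hR',
      average_closedBall_eq _ _ (by positivity : 0 < (1 + s) / 2)]
    set b : Fin d → ℝ := fun _ => (1 - s) / 2 with hb
    have hc2 : Continuous fun w : Fin d → ℝ =>
        ω (t * ‖b + ((1 + s) / 2) • (fun i => e i * w i)‖) :=
      hω.continuous_comp (by fun_prop) fun _ => by positivity
    rw [← average_unitBall_reflect (fun w => ω (t * ‖b + ((1 + s) / 2) • w‖)) he1,
      ← average_closedBall_add (by fun_prop) hc2]
    refine average_closedBall_mono (by fun_prop) (Continuous.add (by fun_prop) hc2) fun w _ => ?_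
    have h1 := (abs_le.1 (hg (c + R • w)
      (c + (t * ((1 - s) / 2)) • e + (R + t * ((1 + s) / 2)) • w))).2
    have h2 : ‖c + R • w - (c + (t * ((1 - s) / 2)) • e + (R + t * ((1 + s) / 2)) • w)‖ =
        t * ‖b + ((1 + s) / 2) • (fun i => e i * w i)‖ := by
      rw [← abs_of_pos ht, ← Real.norm_eq_abs, ← norm_smul, Real.norm_eq_abs, abs_of_pos ht,
        Pi.norm_def, Pi.norm_def]
      congr 2
      ext i
      simp only [coe_nnnorm, Pi.sub_apply, Pi.add_apply, Pi.smul_apply, smul_eq_mul, hb,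
        Real.norm_eq_abs]
      rcases he1 i with h | h <;> rw [h]
      · rw [← abs_neg]; congr 1; ring
      · congr 1; ring
    rw [h2] at h1
    simp only [Pi.add_apply]
    linarith

end CubeAverage

section Extremal

variable {d : ℕ} {ω : ℝ → ℝ}

/-- An interval containing `t` occupies `[-r,r]` no better than the interval `[-st,t]`
for a suitable `s`. -/
lemma exists_interval_comparison {R t : ℝ} (hR : 0 < R) (ht : 0 < t) :
    ∃ s : ℝ, 0 ≤ s ∧ s ≤ 1 ∧ ∀ r, 0 ≤ r → r ≤ t → ∀ a, |t - a| ≤ R →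
      min r (a + R) - max (-r) (a - R) ≤ 2 * R / ((1 + s) * t) * (r + min r (s * t)) := by
  rcases le_total (2 * R) t with h | h
  · refine ⟨0, le_rfl, zero_le_one, fun r hr hrt a ha => ?_⟩
    obtain ⟨h1, h2⟩ := abs_le.1 ha
    have h3 : min r (a + R) - max (-r) (a - R) ≤ r - (t - 2 * R) := by
      have := min_le_left r (a + R)
      have := le_max_right (-r) (a - R)
      linarith
    refine h3.trans ?_
    rw [zero_mul, min_eq_right hr, add_zero, add_zero, one_mul, div_mul_eq_mul_div, le_div_iff₀ ht]
    nlinarith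
  rcases le_total (2 * R) (2 * t) with h' | h'
  · refine ⟨2 * R / t - 1, sub_nonneg.2 ((one_le_div ht).2 h), ?_, fun r hr hrt a ha => ?_⟩
    · rw [sub_le_iff_le_add, div_le_iff₀ ht]
      linarith
    obtain ⟨h1, h2⟩ := abs_le.1 ha
    have e1 : (1 + (2 * R / t - 1)) * t = 2 * R := by field_simp; ring
    have e2 : (2 * R / t - 1) * t = 2 * R - t := by field_simp
    rw [e1, e2, div_self (by positivity), one_mul]
    have h3 := min_le_left r (a + R)
    have h4 := le_max_right (-r) (a - R)
    have h5 := le_max_left (-r) (a - R)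
    rcases min_choice r (2 * R - t) with h6 | h6 <;> rw [h6] <;> linarith
  · refine ⟨1, zero_le_one, le_rfl, fun r hr hrt a ha => ?_⟩
    have h3 := min_le_left r (a + R)
    have h5 := le_max_left (-r) (a - R)
    rw [one_mul, min_eq_left hrt, div_mul_eq_mul_div, le_div_iff₀ (by positivity)]
    nlinarith

/-- The extremal function: a radial peak of height `ω t` and radius `t`. -/
noncomputable def peak (ω : ℝ → ℝ) (t : ℝ) (x : Fin d → ℝ) : ℝ := ω t - ω (min ‖x‖ t)

lemma peak_le (hω : IsModulus ω) {t : ℝ} (ht : 0 < t) (x : Fin d → ℝ) : peak ω t x ≤ ω t :=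
  sub_le_self _ (hω.nonneg _ (le_min (norm_nonneg _) ht.le))

lemma peak_nonneg (hω : IsModulus ω) {t : ℝ} (ht : 0 < t) (x : Fin d → ℝ) : 0 ≤ peak ω t x :=
  sub_nonneg.2 (hω.mono (mem_Ici.2 (le_min (norm_nonneg _) ht.le)) (mem_Ici.2 ht.le)
    (min_le_right _ _))

lemma abs_peak_sub_le (hω : IsModulus ω) {t : ℝ} (ht : 0 < t) (x y : Fin d → ℝ) :
    |peak ω t x - peak ω t y| ≤ ω ‖x - y‖ := by
  have h1 : |peak ω t x - peak ω t y| = |ω (min ‖y‖ t) - ω (min ‖x‖ t)| := by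
    simp only [peak]; congr 1; ring
  have h2 : |min ‖y‖ t - min ‖x‖ t| ≤ ‖x - y‖ := by
    have := abs_min_sub_min_le_max ‖y‖ t ‖x‖ t
    rw [sub_self, abs_zero, max_eq_left (abs_nonneg _)] at this
    rw [norm_sub_rev]
    exact this.trans (abs_norm_sub_norm_le _ _)
  rw [h1]
  exact (hω.abs_sub_le (le_min (norm_nonneg _) ht.le) (le_min (norm_nonneg _) ht.le)).trans
    (hω.mono (mem_Ici.2 (abs_nonneg _)) (mem_Ici.2 (norm_nonneg _)) h2)

lemma peak_zero (hω : IsModulus ω) {t : ℝ} (ht : 0 < t) : peak ω t (0 : Fin d → ℝ) = ω t := by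
  simp [peak, ht.le, hω.map_zero]

/-- Upper level sets of the peak are empty or cubes centered at the origin. -/
lemma levelSet_peak (hω : IsModulus ω) {t r : ℝ} (ht : 0 < t) (hr : 0 < r) :
    {x : Fin d → ℝ | r ≤ peak ω t x} = ∅ ∨
      ∃ ρ, 0 ≤ ρ ∧ ρ ≤ t ∧ {x : Fin d → ℝ | r ≤ peak ω t x} = Metric.closedBall 0 ρ := by
  set S : Set ℝ := Icc 0 t ∩ (fun u => ω t - ω u) ⁻¹' Ici r with hS
  have hmem : ∀ x : Fin d → ℝ, r ≤ peak ω t x → min ‖x‖ t ∈ S := fun x hx =>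
    ⟨⟨le_min (norm_nonneg _) ht.le, min_le_right _ _⟩, hx⟩
  rcases S.eq_empty_or_nonempty with h | h
  · left
    rw [eq_empty_iff_forall_notMem]
    intro x hx
    have := hmem x hx
    rw [h] at this
    exact this
  · right
    have hcomp : IsCompact S := by
      have hc : ContinuousOn (fun u => ω t - ω u) (Icc 0 t) :=
        continuousOn_const.sub (hω.cont.mono Icc_subset_Ici_self)
      exact isCompact_Icc.of_isClosed_subset
        (hc.preimage_isClosed_of_isClosed isClosed_Icc isClosed_Ici) inter_subset_left
    obtain ⟨ρ, ⟨⟨hρ0, hρt⟩, hρr⟩, hρ⟩ := hcomp.exists_isGreatest h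
    refine ⟨ρ, hρ0, hρt, ?_⟩
    ext x
    rw [mem_closedBall_zero_iff, mem_ofPred_eq]
    constructor
    · intro hx
      have hle := hρ (hmem x hx)
      rcases min_le_iff.1 hle with h' | h'
      · exact h'
      · have : ρ = t := le_antisymm hρt h'
        simp only [mem_preimage, mem_Ici, this, sub_self] at hρr
        linarith
    · intro hx
      have h1 : min ‖x‖ t = ‖x‖ := min_eq_left (hx.trans hρt)
      have h2 := hω.mono (mem_Ici.2 (norm_nonneg x)) (mem_Ici.2 hρ0) hx
      have h3 : r ≤ ω t - ω ρ := hρr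
      rw [peak, h1]
      linarith

/-- Among cubes containing the corner `(t,…,t)`, the average of the peak is largest on some
`[-st,t]^d`. -/
lemma average_peak_le (hd : 1 ≤ d) (hω : IsModulus ω) {c : Fin d → ℝ} {R t : ℝ} (hR : 0 < R)
    (ht : 0 < t) (hx : (fun _ => t) ∈ Metric.closedBall c R) :
    ∃ s : ℝ, 0 ≤ s ∧ s ≤ 1 ∧ ⨍ y in Metric.closedBall c R, peak ω t y ≤ ω t -
      ⨍ z in Metric.closedBall (fun _ : Fin d => (1 - s) / 2) ((1 + s) / 2), ω (t * ‖z‖) := by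
  obtain ⟨s, hs0, hs1, hs⟩ := exists_interval_comparison hR ht
  refine ⟨s, hs0, hs1, ?_⟩
  have hpc : Continuous (peak ω t : (Fin d → ℝ) → ℝ) :=
    hω.continuous_of_le (abs_peak_sub_le hω ht)
  set κ : ℝ := 2 * R / ((1 + s) * t) with hκ
  have hκ0 : 0 < κ := by positivity
  set cs : Fin d → ℝ := fun _ => (1 - s) / 2 with hcs
  have hRs : 0 < t * ((1 + s) / 2) := by positivity
  have hxc : ∀ i, |t - c i| ≤ R := by
    rw [mem_closedBall_iff_norm, pi_norm_le_iff_of_nonneg hR.le] at hx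
    exact hx
  have hmeas : ∀ r, 0 < r →
      (volume.restrict (Metric.closedBall c R)) {x | r ≤ peak ω t x} ≤
      (ENNReal.ofReal (κ ^ d) • volume.restrict (Metric.closedBall (t • cs) (t * ((1 + s) / 2))))
        {x | r ≤ peak ω t x} := by
    intro r hr
    rcases levelSet_peak (d := d) hω ht hr with h | ⟨ρ, hρ0, hρt, h⟩
    · simp [h]
    rw [h, Measure.smul_apply, Measure.restrict_apply Metric.isClosed_closedBall.measurableSet,
      Measure.restrict_apply Metric.isClosed_closedBall.measurableSet,
      volume_closedBall_inter_closedBall hd, volume_closedBall_inter_closedBall hd]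
    have e : ∀ i, min ρ ((t • cs) i + t * ((1 + s) / 2)) -
        max (-ρ) ((t • cs) i - t * ((1 + s) / 2)) = ρ + min ρ (s * t) := by
      intro i
      have e1 : (t • cs) i + t * ((1 + s) / 2) = t := by
        simp only [hcs, Pi.smul_apply, smul_eq_mul]; ring
      have e2 : (t • cs) i - t * ((1 + s) / 2) = -(s * t) := by
        simp only [hcs, Pi.smul_apply, smul_eq_mul]; ring
      rw [e1, e2, min_eq_left hρt, max_neg_neg, sub_neg_eq_add]
    simp only [e]
    rw [Finset.prod_const, Finset.card_univ, Fintype.card_fin, smul_eq_mul,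
      ENNReal.ofReal_pow hκ0.le, ← mul_pow, ← ENNReal.ofReal_mul hκ0.le]
    calc ∏ i, ENNReal.ofReal (min ρ (c i + R) - max (-ρ) (c i - R))
        ≤ ∏ _i : Fin d, ENNReal.ofReal (κ * (ρ + min ρ (s * t))) :=
          Finset.prod_le_prod' fun i _ => ENNReal.ofReal_le_ofReal (hs ρ hρ0 hρt (c i) (hxc i))
      _ = _ := by simp
  have : IsFiniteMeasure (ENNReal.ofReal (κ ^ d) •
      (volume.restrict (Metric.closedBall (t • cs) (t * ((1 + s) / 2))))) := by
    have : IsFiniteMeasure (volume.restrict (Metric.closedBall (t • cs) (t * ((1 + s) / 2)))) :=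
      ⟨by simpa using (isCompact_closedBall (t • cs) _).measure_lt_top⟩
    exact Measure.smul_finite _ ENNReal.ofReal_ne_top
  have hint := integral_le_integral_of_meas_le hpc.measurable (peak_nonneg hω ht)
    (peak_le hω ht) hmeas
  rw [integral_smul_measure, ENNReal.toReal_ofReal (by positivity), smul_eq_mul] at hint
  have h1 : ⨍ y in Metric.closedBall c R, peak ω t y ≤
      ⨍ y in Metric.closedBall (t • cs) (t * ((1 + s) / 2)), peak ω t y := by
    rw [setAverage_eq, setAverage_eq, smul_eq_mul, smul_eq_mul,
      volume_real_closedBall_pi _ hR.le, volume_real_closedBall_pi _ hRs.le,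
      inv_mul_le_iff₀ (by positivity), ← mul_assoc]
    refine hint.trans_eq ?_
    congr 1
    rw [hκ, div_pow, div_eq_mul_inv]
    congr 3
    ring
  refine h1.trans ?_
  rw [average_closedBall_eq _ _ hRs,
    average_closedBall_eq _ _ (by positivity : 0 < (1 + s) / 2), le_sub_iff_add_le]
  have hc1 : Continuous fun w : Fin d → ℝ => ω (t * ‖cs + ((1 + s) / 2) • w‖) :=
    hω.continuous_comp (by fun_prop) fun _ => by positivity
  have hc2 : Continuous fun w : Fin d → ℝ => peak ω t (t • cs + (t * ((1 + s) / 2)) • w) := by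
    fun_prop
  rw [← average_closedBall_add hc2 hc1, ← average_closedBall_const (ω t) 0 (zero_lt_one' ℝ)]
  refine average_closedBall_mono (hc2.add hc1) continuous_const fun w hw => ?_
  rw [mem_closedBall_zero_iff] at hw
  have hn : ‖cs + ((1 + s) / 2) • w‖ ≤ 1 := by
    refine (norm_add_le _ _).trans ?_
    have h2 : ‖cs‖ ≤ (1 - s) / 2 := by
      refine (pi_norm_le_iff_of_nonneg (by linarith)).2 fun i => ?_
      rw [Real.norm_eq_abs, abs_of_nonneg (by simp only [hcs]; linarith)]
    rw [norm_smul, Real.norm_eq_abs, abs_of_pos (by positivity)]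
    nlinarith
  have hts : ‖t • cs + (t * ((1 + s) / 2)) • w‖ = t * ‖cs + ((1 + s) / 2) • w‖ := by
    rw [mul_smul, ← smul_add, norm_smul, Real.norm_eq_abs, abs_of_pos ht]
  simp only [Pi.add_apply, peak, hts, min_eq_left (mul_le_of_le_one_right ht.le hn),
    sub_add_cancel, le_refl]

end Extremal

section OperatorNorm

variable {d : ℕ} {ω : ℝ → ℝ}

/-- The infimum over `s` in the formula for the operator norm. -/
noncomputable def cubeInf (d : ℕ) (ω : ℝ → ℝ) (t : ℝ) : ℝ :=
  sInf {b : ℝ | ∃ s : ℝ, 0 ≤ s ∧ s ≤ 1 ∧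
    b = (∫ x in Icc (fun _ : Fin d => -s) (fun _ : Fin d => 1), ω (t * ‖x‖)) /
      ((1 + s) ^ d * ω t)}

lemma cubeInf_eq (hd : 1 ≤ d) (t : ℝ) :
    cubeInf d ω t = sInf {b : ℝ | ∃ s : ℝ, 0 ≤ s ∧ s ≤ 1 ∧
      b = (⨍ z in Metric.closedBall (fun _ : Fin d => (1 - s) / 2) ((1 + s) / 2),
        ω (t * ‖z‖)) / ω t} := by
  rw [cubeInf]
  congr 1
  ext b
  refine exists_congr fun s => and_congr_right fun hs => ?_
  rw [← integral_Icc_div_eq_average hd hs, div_div]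

lemma average_modulus_nonneg (hω : IsModulus ω) {t : ℝ} (ht : 0 < t) (c : Fin d → ℝ) (R : ℝ) :
    0 ≤ ⨍ z in Metric.closedBall c R, ω (t * ‖z‖) := by
  rw [setAverage_eq]
  exact smul_nonneg (inv_nonneg.2 measureReal_nonneg)
    (integral_nonneg fun z => hω.nonneg _ (by positivity))

lemma bddBelow_cubeInf (hω : IsModulus ω) {t : ℝ} (ht : 0 < t) :
    BddBelow {b : ℝ | ∃ s : ℝ, 0 ≤ s ∧ s ≤ 1 ∧
      b = (⨍ z in Metric.closedBall (fun _ : Fin d => (1 - s) / 2) ((1 + s) / 2),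
        ω (t * ‖z‖)) / ω t} := by
  refine ⟨0, ?_⟩
  rintro _ ⟨s, -, -, rfl⟩
  exact div_nonneg (average_modulus_nonneg hω ht _ _) (hω.nonneg t ht.le)

lemma cubeInf_mul_le (hd : 1 ≤ d) (hω : IsModulus ω) {t s : ℝ} (ht : 0 < t) (hs0 : 0 ≤ s)
    (hs1 : s ≤ 1) : cubeInf d ω t * ω t ≤
      ⨍ z in Metric.closedBall (fun _ : Fin d => (1 - s) / 2) ((1 + s) / 2), ω (t * ‖z‖) := by
  rw [← le_div_iff₀ (hω.pos ht), cubeInf_eq hd]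
  exact csInf_le (bddBelow_cubeInf hω ht) ⟨s, hs0, hs1, rfl⟩

lemma le_cubeInf_mul (hd : 1 ≤ d) (hω : IsModulus ω) {t a : ℝ} (ht : 0 < t)
    (h : ∀ s, 0 ≤ s → s ≤ 1 → a ≤
      ⨍ z in Metric.closedBall (fun _ : Fin d => (1 - s) / 2) ((1 + s) / 2), ω (t * ‖z‖)) :
    a ≤ cubeInf d ω t * ω t := by
  rw [← div_le_iff₀ (hω.pos ht), cubeInf_eq hd]
  refine le_csInf ⟨_, 0, le_rfl, zero_le_one, rfl⟩ ?_
  rintro _ ⟨s, hs0, hs1, rfl⟩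
  exact div_le_div_of_nonneg_right (h s hs0 hs1) (hω.pos ht).le

lemma cubeInf_nonneg (hd : 1 ≤ d) (hω : IsModulus ω) {t : ℝ} (ht : 0 < t) :
    0 ≤ cubeInf d ω t := by
  have := le_cubeInf_mul (a := 0) hd hω ht fun s _ _ => average_modulus_nonneg hω ht _ _
  exact nonneg_of_mul_nonneg_left this (hω.pos ht)

lemma cubeInf_le_one (hd : 1 ≤ d) (hω : IsModulus ω) {t : ℝ} (ht : 0 < t) :
    cubeInf d ω t ≤ 1 := by
  refine le_of_mul_le_mul_right ?_ (hω.pos ht)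
  rw [one_mul]
  refine (cubeInf_mul_le hd hω ht zero_le_one le_rfl).trans ?_
  rw [← average_closedBall_const (ω t) (fun _ : Fin d => (1 - 1) / 2)
    (by norm_num : (0 : ℝ) < (1 + 1) / 2)]
  refine average_closedBall_mono (hω.continuous_comp (by fun_prop) fun _ => by positivity)
    continuous_const fun z hz => ?_
  have h0 : (fun _ : Fin d => ((1 : ℝ) - 1) / 2) = 0 := by ext; simp
  rw [h0, mem_closedBall_zero_iff] at hz
  norm_num at hz
  exact hω.mono (mem_Ici.2 (by positivity)) (mem_Ici.2 ht.le) (mul_le_of_le_one_right ht.le hz)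

lemma average_le_maxFn {f : (Fin d → ℝ) → ℝ} {y c : Fin d → ℝ} {R : ℝ}
    (hb : BddAbove {a : ℝ | ∃ c : Fin d → ℝ, ∃ R : ℝ, 0 < R ∧ y ∈ nball (fun x => ‖x‖) c R ∧
      a = ⨍ z in nball (fun x => ‖x‖) c R, |f z|}) (hR : 0 < R) (hy : y ∈ Metric.closedBall c R) :
    ⨍ z in Metric.closedBall c R, |f z| ≤ maxFn (fun x => ‖x‖) f y :=
  le_csSup hb ⟨c, R, hR, by rwa [nball_norm_eq], by rw [nball_norm_eq]⟩

lemma maxFn_le {f : (Fin d → ℝ) → ℝ} {y : Fin d → ℝ} {C : ℝ}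
    (h : ∀ c : Fin d → ℝ, ∀ R, 0 < R → y ∈ Metric.closedBall c R →
      ⨍ z in Metric.closedBall c R, |f z| ≤ C) : maxFn (fun x => ‖x‖) f y ≤ C := by
  refine csSup_le ⟨_, y, 1, one_pos, by simp [nball_norm_eq], rfl⟩ ?_
  rintro _ ⟨c, R, hR, hy, rfl⟩
  rw [nball_norm_eq] at hy ⊢
  exact h c R hR hy

lemma maxFn_le_add (hd : 1 ≤ d) (hω : IsModulus ω) {f : (Fin d → ℝ) → ℝ}
    (hf : ∀ x y, |f x - f y| ≤ ω ‖x - y‖) {x y : Fin d → ℝ} (hxy : x ≠ y)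
    (hb : BddAbove {a : ℝ | ∃ c : Fin d → ℝ, ∃ R : ℝ, 0 < R ∧ y ∈ nball (fun x => ‖x‖) c R ∧
      a = ⨍ z in nball (fun x => ‖x‖) c R, |f z|}) :
    BddAbove {a : ℝ | ∃ c : Fin d → ℝ, ∃ R : ℝ, 0 < R ∧ x ∈ nball (fun x => ‖x‖) c R ∧
      a = ⨍ z in nball (fun x => ‖x‖) c R, |f z|} ∧
    maxFn (fun x => ‖x‖) f x ≤
      maxFn (fun x => ‖x‖) f y + cubeInf d ω ‖x - y‖ * ω ‖x - y‖ := by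
  have hpos : 0 < ‖x - y‖ := norm_pos_iff.2 (sub_ne_zero.2 hxy)
  have habs : ∀ x y, |(|f x| - |f y|)| ≤ ω ‖x - y‖ := fun x y =>
    (abs_abs_sub_abs_le_abs_sub _ _).trans (hf x y)
  have key : ∀ c : Fin d → ℝ, ∀ R, 0 < R → x ∈ Metric.closedBall c R →
      ⨍ z in Metric.closedBall c R, |f z| ≤
        maxFn (fun x => ‖x‖) f y + cubeInf d ω ‖x - y‖ * ω ‖x - y‖ := by
    intro c R hR hx
    rw [← sub_le_iff_le_add']
    refine le_cubeInf_mul hd hω hpos fun s hs0 hs1 => ?_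
    obtain ⟨c', R', hR', hy, hle⟩ :=
      average_le_average_add hω habs hR hx hpos le_rfl hs0 hs1
    have := average_le_maxFn hb hR' hy
    linarith
  refine ⟨⟨maxFn (fun x => ‖x‖) f y + cubeInf d ω ‖x - y‖ * ω ‖x - y‖, ?_⟩, maxFn_le key⟩
  rintro _ ⟨c, R, hR, hx, rfl⟩
  rw [nball_norm_eq] at hx ⊢
  exact key c R hR hx

lemma abs_maxFn_sub_le (hd : 1 ≤ d) (hω : IsModulus ω) {f : (Fin d → ℝ) → ℝ}
    (hf : ∀ x y, |f x - f y| ≤ ω ‖x - y‖) {K : ℝ} (hK : ∀ t, 0 < t → cubeInf d ω t ≤ K)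
    (x y : Fin d → ℝ) :
    |maxFn (fun x => ‖x‖) f x - maxFn (fun x => ‖x‖) f y| ≤ K * ω ‖x - y‖ := by
  rcases eq_or_ne x y with rfl | hxy
  · simp [hω.map_zero]
  have hpos : 0 < ‖x - y‖ := norm_pos_iff.2 (sub_ne_zero.2 hxy)
  have hle := mul_le_mul_of_nonneg_right (hK _ hpos) (hω.nonneg _ hpos.le)
  by_cases hb : BddAbove {a : ℝ | ∃ c : Fin d → ℝ, ∃ R : ℝ, 0 < R ∧
      y ∈ nball (fun x => ‖x‖) c R ∧ a = ⨍ z in nball (fun x => ‖x‖) c R, |f z|}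
  · obtain ⟨hb', h1⟩ := maxFn_le_add hd hω hf hxy hb
    obtain ⟨-, h2⟩ := maxFn_le_add hd hω hf hxy.symm hb'
    rw [norm_sub_rev] at h2
    rw [abs_le]
    constructor <;> linarith
  · have hx : maxFn (fun x => ‖x‖) f x = 0 :=
      Real.sSup_of_not_bddAbove fun hb' => hb (maxFn_le_add hd hω hf hxy.symm hb').1
    have hy : maxFn (fun x => ‖x‖) f y = 0 := Real.sSup_of_not_bddAbove hb
    rw [hx, hy, sub_zero, abs_zero]
    exact (mul_nonneg (cubeInf_nonneg hd hω hpos) (hω.nonneg _ hpos.le)).trans hle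

lemma norm_zero_sub_const (hd : 1 ≤ d) {t : ℝ} (ht : 0 < t) :
    ‖(0 : Fin d → ℝ) - fun _ => t‖ = t := by
  have : Nonempty (Fin d) := ⟨⟨0, hd⟩⟩
  rw [zero_sub, norm_neg, pi_norm_const, Real.norm_eq_abs, abs_of_pos ht]

lemma lipNorm_peak (hd : 1 ≤ d) (hω : IsModulus ω) {t : ℝ} (ht : 0 < t) :
    lipNorm (fun x : Fin d → ℝ => ‖x‖) ω (peak ω t) = 1 := by
  have hle : ∀ x y : Fin d → ℝ, |peak ω t x - peak ω t y| ≤ 1 * ω ‖x - y‖ := fun x y => by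
    rw [one_mul]; exact abs_peak_sub_le hω ht x y
  refine le_antisymm (lipNorm_le hω zero_le_one hle) ?_
  have hn := norm_zero_sub_const hd ht
  have hne : (0 : Fin d → ℝ) ≠ fun _ => t := fun h => by
    rw [← h, sub_zero, norm_zero] at hn
    exact ht.ne hn
  have h := div_le_lipNorm hω zero_le_one hle hne
  have hp : peak ω t (fun _ : Fin d => t) = 0 := by
    have : ‖(fun _ : Fin d => t)‖ = t := by rwa [zero_sub, norm_neg] at hn
    rw [peak, this, min_self, sub_self]
  rwa [hn, peak_zero hω ht, hp, sub_zero, abs_of_pos (hω.pos ht), div_self (hω.pos ht).ne'] at h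

lemma bddAbove_average_peak (hω : IsModulus ω) {t : ℝ} (ht : 0 < t) (y : Fin d → ℝ) :
    BddAbove {a : ℝ | ∃ c : Fin d → ℝ, ∃ R : ℝ, 0 < R ∧ y ∈ nball (fun x => ‖x‖) c R ∧
      a = ⨍ z in nball (fun x => ‖x‖) c R, |peak ω t z|} := by
  refine ⟨ω t, ?_⟩
  rintro _ ⟨c, R, hR, -, rfl⟩
  have hpc : Continuous (peak ω t : (Fin d → ℝ) → ℝ) :=
    hω.continuous_of_le (abs_peak_sub_le hω ht)
  rw [nball_norm_eq, ← average_closedBall_const (ω t) c hR]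
  refine average_closedBall_mono hpc.abs continuous_const fun z _ => ?_
  rw [abs_of_nonneg (peak_nonneg hω ht z)]
  exact peak_le hω ht z

lemma le_maxFn_peak_zero (hω : IsModulus ω) {t : ℝ} (ht : 0 < t) :
    ω t ≤ maxFn (fun x : Fin d → ℝ => ‖x‖) (peak ω t) 0 := by
  have hpc : Continuous (peak ω t : (Fin d → ℝ) → ℝ) :=
    hω.continuous_of_le (abs_peak_sub_le hω ht)
  have key : ∀ R, 0 < R → ω t - ω R ≤ maxFn (fun x : Fin d → ℝ => ‖x‖) (peak ω t) 0 := by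
    intro R hR
    refine le_trans ?_ (average_le_maxFn (c := 0) (bddAbove_average_peak hω ht 0) hR
      (Metric.mem_closedBall_self hR.le))
    rw [← average_closedBall_const (ω t - ω R) (0 : Fin d → ℝ) hR]
    refine average_closedBall_mono continuous_const hpc.abs fun z hz => ?_
    rw [mem_closedBall_zero_iff] at hz
    rw [abs_of_nonneg (peak_nonneg hω ht z), peak]
    have := hω.mono (mem_Ici.2 (le_min (norm_nonneg z) ht.le)) (mem_Ici.2 hR.le)
      ((min_le_left _ t).trans hz)
    linarith
  have hlim : Tendsto (fun R => ω t - ω R) (𝓝[>] 0) (𝓝 (ω t)) := by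
    simpa using tendsto_const_nhds.sub hω.tendsto_zero
  exact le_of_tendsto hlim (eventually_nhdsWithin_of_forall fun R hR => key R hR)

lemma maxFn_peak_corner_le (hd : 1 ≤ d) (hω : IsModulus ω) {t : ℝ} (ht : 0 < t) :
    maxFn (fun x : Fin d → ℝ => ‖x‖) (peak ω t) (fun _ => t) ≤
      ω t - cubeInf d ω t * ω t := by
  refine maxFn_le fun c R hR hx => ?_
  obtain ⟨s, hs0, hs1, h⟩ := average_peak_le hd hω hR ht hx
  simp only [abs_of_nonneg (peak_nonneg hω ht _)]
  have := cubeInf_mul_le hd hω ht hs0 hs1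
  linarith

lemma cubeInf_le_lipNorm_maxFn_peak (hd : 1 ≤ d) (hω : IsModulus ω) {t : ℝ} (ht : 0 < t) :
    cubeInf d ω t ≤
      lipNorm (fun x : Fin d → ℝ => ‖x‖) ω (maxFn (fun x : Fin d → ℝ => ‖x‖) (peak ω t)) := by
  have hn := norm_zero_sub_const hd ht
  have hne : (0 : Fin d → ℝ) ≠ fun _ => t := fun h => by
    rw [← h, sub_zero, norm_zero] at hn
    exact ht.ne hn
  refine le_trans ?_ (div_le_lipNorm hω zero_le_one (abs_maxFn_sub_le hd hω
    (abs_peak_sub_le hω ht) fun u hu => cubeInf_le_one hd hω hu) hne)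
  rw [hn, le_div_iff₀ (hω.pos ht)]
  refine le_trans ?_ (le_abs_self _)
  have h1 := le_maxFn_peak_zero (d := d) hω ht
  have h2 := maxFn_peak_corner_le hd hω ht
  linarith

/-- The operator norm is the supremum over scales of `cubeInf`. -/
lemma opNorm_eq_sSup_cubeInf (hd : 1 ≤ d) (hω : IsModulus ω) :
    opNorm d (fun x => ‖x‖) ω = sSup {a : ℝ | ∃ t : ℝ, 0 < t ∧ a = cubeInf d ω t} := by
  set K := sSup {a : ℝ | ∃ t : ℝ, 0 < t ∧ a = cubeInf d ω t} with hKdef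
  have hbK : BddAbove {a : ℝ | ∃ t : ℝ, 0 < t ∧ a = cubeInf d ω t} := by
    refine ⟨1, ?_⟩
    rintro _ ⟨t, ht, rfl⟩
    exact cubeInf_le_one hd hω ht
  have hK : ∀ t, 0 < t → cubeInf d ω t ≤ K := fun t ht => le_csSup hbK ⟨t, ht, rfl⟩
  have hK0 : 0 ≤ K := (cubeInf_nonneg hd hω one_pos).trans (hK 1 one_pos)
  have hup : ∀ a ∈ {a : ℝ | ∃ f : (Fin d → ℝ) → ℝ, lipNorm (fun x => ‖x‖) ω f = 1 ∧
      a = lipNorm (fun x => ‖x‖) ω (maxFn (fun x => ‖x‖) f)}, a ≤ K := by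
    rintro _ ⟨f, hf, rfl⟩
    exact lipNorm_le hω hK0
      (abs_maxFn_sub_le hd hω (abs_sub_le_of_lipNorm_eq_one hω hf) hK)
  refine le_antisymm (Real.sSup_le hup hK0) (csSup_le ⟨_, 1, one_pos, rfl⟩ ?_)
  rintro _ ⟨t, ht, rfl⟩
  exact (cubeInf_le_lipNorm_maxFn_peak hd hω ht).trans
    (le_csSup ⟨K, hup⟩ ⟨_, lipNorm_peak hd hω ht, rfl⟩)

/-- The formula for `cubeInf` in polar coordinates. -/
lemma cubeInf_eq_polar (hd : 1 ≤ d) (hω : IsModulus ω) {t : ℝ} (ht : 0 < t) :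
    cubeInf d ω t = sInf {b : ℝ | ∃ s : ℝ, 0 ≤ s ∧ s ≤ 1 ∧
      b = ((d : ℝ) / ((1 + s) ^ d * ω t)) *
        (2 ^ d * (∫ u in Icc (0 : ℝ) s, u ^ (d - 1) * ω (t * u)) +
          ∫ u in Icc s (1 : ℝ), (u + s) ^ (d - 1) * ω (t * u))} := by
  rw [cubeInf]
  congr 1
  ext b
  refine exists_congr fun s => and_congr_right fun hs0 => and_congr_right fun hs1 => ?_
  have hc : ContinuousOn (fun u => ω (t * u)) (Ici 0) :=
    hω.cont.comp (by fun_prop) fun u hu => mul_nonneg ht.le hu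
  rw [setIntegral_Icc_radial hd hs0 hs1 hc, mul_div_right_comm]

end OperatorNorm

/-- Integral formulas for the operator norm of the uncentered maximal operator associated to
`ℓ∞` balls (axis-parallel cubes) on `Lip(ω)`, for the `ℓ∞` distance.  (On `Fin d → ℝ` the
default norm `‖·‖` is the sup norm.) -/
theorem stmt5 (d : ℕ) (hd : 1 ≤ d) (ω : ℝ → ℝ) (hω : IsModulus ω) :
    opNorm d (fun x => ‖x‖) ω =
      sSup {a : ℝ | ∃ t : ℝ, 0 < t ∧
        a = sInf {b : ℝ | ∃ s : ℝ, 0 ≤ s ∧ s ≤ 1 ∧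
          b = (∫ x in Set.Icc (fun _ : Fin d => -s) (fun _ : Fin d => 1), ω (t * ‖x‖)) /
                ((1 + s) ^ d * ω t)}} ∧
    opNorm d (fun x => ‖x‖) ω =
      sSup {a : ℝ | ∃ t : ℝ, 0 < t ∧
        a = sInf {b : ℝ | ∃ s : ℝ, 0 ≤ s ∧ s ≤ 1 ∧
          b = ((d : ℝ) / ((1 + s) ^ d * ω t)) *
                (2 ^ d * (∫ u in Set.Icc (0 : ℝ) s, u ^ (d - 1) * ω (t * u)) +
                  ∫ u in Set.Icc s (1 : ℝ), (u + s) ^ (d - 1) * ω (t * u))}} := by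
  refine ⟨opNorm_eq_sSup_cubeInf hd hω, ?_⟩
  rw [opNorm_eq_sSup_cubeInf hd hω]
  congr 1
  ext a
  refine exists_congr fun t => and_congr_right fun ht => ?_
  rw [cubeInf_eq_polar hd hω ht]
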